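/- Every zero of the function g₂(τ)² − 18η₁(τ)g₃(τ) on the upper half-plane is simple; equivalently, every zero of g₃'(τ) is simple. -/

import Mathlib

open Complex Filter Asymptotics Set

noncomputable section

/-- q = e^{2πiτ} -/
def qq (τ : ℂ) : ℂ := Complex.exp (2 * (Real.pi : ℂ) * Complex.I * τ)

/-- divisor power sum σ_k(n) as a complex number -/
def sigmaC (k n : ℕ) : ℂ := ∑ d ∈ n.divisors, (d : ℂ) ^ k

/-- normalized Eisenstein series E₂ -/
def E2 (τ : ℂ) : ℂ := 1 - 24 * ∑' n : ℕ, sigmaC 1 (n + 1) * qq τ ^ (n + 1)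

/-- normalized Eisenstein series E₄ -/
def E4 (τ : ℂ) : ℂ := 1 + 240 * ∑' n : ℕ, sigmaC 3 (n + 1) * qq τ ^ (n + 1)

/-- normalized Eisenstein series E₆ -/
def E6 (τ : ℂ) : ℂ := 1 - 504 * ∑' n : ℕ, sigmaC 5 (n + 1) * qq τ ^ (n + 1)

/-- elliptic invariant g₂ -/
def g2 (τ : ℂ) : ℂ := (4 * (Real.pi : ℂ) ^ 4 / 3) * E4 τ

/-- elliptic invariant g₃ -/
def g3 (τ : ℂ) : ℂ := (8 * (Real.pi : ℂ) ^ 6 / 27) * E6 τ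

/-- quasi-period η₁ -/
def eta1 (τ : ℂ) : ℂ := ((Real.pi : ℂ) ^ 2 / 3) * E2 τ

/-- quasi-period η₂ (Legendre relation) -/
def eta2 (τ : ℂ) : ℂ := τ * eta1 τ - 2 * (Real.pi : ℂ) * Complex.I

/-- the function h = g₂² − 18η₁g₃ -/
def hh (τ : ℂ) : ℂ := g2 τ ^ 2 - 18 * eta1 τ * g3 τ

/-- the family f_C -/
def f (C τ : ℂ) : ℂ := (C - τ) * g2 τ ^ 2 - 18 * (C * eta1 τ - eta2 τ) * g3 τ

end


noncomputable section

open UpperHalfPlane hiding I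
open ModularForm ModularGroup MatrixGroups Manifold Topology

def F4 : ModularForm 𝒮ℒ 4 := ModularForm.E (k := 4) (by norm_num)
def F6 : ModularForm 𝒮ℒ 6 := ModularForm.E (k := 6) (by norm_num)

lemma sigmaC_eq (k n : ℕ) : sigmaC k n = (ArithmeticFunction.sigma k n : ℂ) := by
  simp [sigmaC, ArithmeticFunction.sigma_apply]

lemma E2_coe (z : ℍ) : E2 z = EisensteinSeries.E2 z := by
  rw [EisensteinSeries.E2_eq_tsum_cexp, E2,
    tsum_pnat_eq_tsum_succ (f := fun n ↦ (ArithmeticFunction.sigma 1 n : ℂ) * cexp (2 * Real.pi * I * z) ^ n)]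
  simp [sigmaC_eq, qq]

lemma E4_coe (z : ℍ) : E4 z = F4 z := by
  have := EisensteinSeries.q_expansion_bernoulli (k := 4) (by norm_num) ⟨2, rfl⟩ z
  simp_rw [zpow_natCast] at this
  rw [F4, this, E4,
    tsum_pnat_eq_tsum_succ (f := fun n ↦ (ArithmeticFunction.sigma (4 - 1) n : ℂ) * cexp (2 * Real.pi * I * z) ^ n)]
  norm_num [sigmaC_eq, qq, show bernoulli 4 = -1 / 30 by decide +kernel]

lemma E6_coe (z : ℍ) : E6 z = F6 z := by
  have := EisensteinSeries.q_expansion_bernoulli (k := 6) (by norm_num) ⟨3, rfl⟩ z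
  simp_rw [zpow_natCast] at this
  rw [F6, this, E6,
    tsum_pnat_eq_tsum_succ (f := fun n ↦ (ArithmeticFunction.sigma (6 - 1) n : ℂ) * cexp (2 * Real.pi * I * z) ^ n)]
  norm_num [sigmaC_eq, qq, show bernoulli 6 = 1 / 42 by decide +kernel]

lemma norm_qq (z : ℂ) : ‖qq z‖ = Real.exp (-2 * Real.pi * z.im) := by
  simp [qq, Complex.norm_exp]

lemma summable_sq (k : ℕ) (z : ℍ) :
    Summable fun n : ℕ ↦ sigmaC k (n + 1) * qq z ^ (n + 1) := by
  have := (summable_nat_add_iff 1).mpr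
    (EisensteinSeries.summable_sigma_mul_cexp_pow (k := k + 1) (by omega) z)
  simpa [sigmaC_eq, qq] using this

lemma tendsto_sq (k : ℕ) :
    Tendsto (fun z : ℍ ↦ ∑' n : ℕ, sigmaC k (n + 1) * qq z ^ (n + 1)) atImInfty (𝓝 0) := by
  have hq : Tendsto (fun z : ℍ ↦ qq z) atImInfty (𝓝 0) := by
    have := qParam_tendsto_atImInfty (h := 1) one_pos
    simpa [Function.Periodic.qParam, qq] using this
  rw [show (0 : ℂ) = ∑' n : ℕ, (0 : ℂ) by simp]
  apply tendsto_tsum_of_dominated_convergence (summable_sq k UpperHalfPlane.I).norm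
  · intro n
    simpa using (hq.pow (n + 1)).const_mul (sigmaC k (n + 1))
  · rw [Filter.Eventually, atImInfty_mem]
    refine ⟨1, fun z hz n ↦ ?_⟩
    rw [norm_mul, norm_mul, norm_pow, norm_pow, norm_qq, norm_qq]
    gcongr _ * Real.exp ?_ ^ _
    have : ((UpperHalfPlane.I : ℍ) : ℂ).im = 1 := by simp
    rw [this]
    have h2 : 1 ≤ (z : ℂ).im := hz
    nlinarith [Real.pi_pos]

lemma tendsto_F2 : Tendsto EisensteinSeries.E2 atImInfty (𝓝 1) := by
  have := ((tendsto_sq 1).const_mul 24).const_sub 1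
  simp only [mul_zero, sub_zero] at this
  exact this.congr fun z ↦ E2_coe z

lemma tendsto_F4 : Tendsto F4 atImInfty (𝓝 1) := by
  have := ((tendsto_sq 3).const_mul 240).const_add 1
  simp only [mul_zero, add_zero] at this
  exact this.congr fun z ↦ E4_coe z

lemma tendsto_F6 : Tendsto F6 atImInfty (𝓝 1) := by
  have := ((tendsto_sq 5).const_mul 504).const_sub 1
  simp only [mul_zero, sub_zero] at this
  exact this.congr fun z ↦ E6_coe z

lemma tendsto_D {F : ℍ → ℂ} {c : ℂ} (hF : MDiff F) (h : Tendsto F atImInfty (𝓝 c)) :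
    Tendsto (Derivative.normalizedDerivOfComplex F) atImInfty (𝓝 0) := by
  change IsZeroAtImInfty _
  rw [isZeroAtImInfty_iff]
  have h0 : IsZeroAtImInfty (fun z ↦ F z - c) := by
    have := h.sub_const c
    rw [sub_self] at this
    exact this
  rw [isZeroAtImInfty_iff] at h0
  rw [UpperHalfPlane.mdifferentiable_iff] at hF
  intro ε hε
  obtain ⟨A, hA⟩ := h0 ε hε
  refine ⟨max A 0 + 2, fun z hz ↦ ?_⟩
  have hsub : ∀ w ∈ Metric.closedBall (z : ℂ) 1, max A 0 < w.im := by
    intro w hw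
    have h1 : |(w - z).im| ≤ 1 := (Complex.abs_im_le_norm _).trans (by simpa [dist_eq_norm] using hw)
    have h2 : max A 0 + 2 ≤ (z : ℂ).im := hz
    rw [Complex.sub_im] at h1
    linarith [neg_abs_le (w.im - (z : ℂ).im)]
  have hd : DiffContOnCl ℂ (fun w ↦ (F ∘ ofComplex) w - c) (Metric.ball (z : ℂ) 1) := by
    apply DifferentiableOn.diffContOnCl
    rw [closure_ball _ one_ne_zero]
    refine (hF.mono fun w hw ↦ ?_).sub_const c
    exact (le_max_right A 0).trans_lt (hsub w hw)
  have key := norm_deriv_le_of_forall_mem_sphere_norm_le (C := ε) one_pos hd (by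
    intro w hw
    have h1 := hsub w (Metric.sphere_subset_closedBall hw)
    have h2 : 0 < w.im := (le_max_right A 0).trans_lt h1
    simp only [Function.comp_apply, ofComplex_apply_of_im_pos h2]
    exact hA _ ((le_max_left A 0).trans h1.le))
  rw [deriv_sub_const, div_one] at key
  rw [Derivative.normalizedDerivOfComplex, norm_mul]
  have h3 : ‖(2 * Real.pi * I : ℂ)⁻¹‖ ≤ 1 := by
    rw [norm_inv]
    apply inv_le_one_of_one_le₀
    simp [abs_of_pos Real.pi_pos]
    nlinarith [Real.pi_gt_three]
  calc _ ≤ 1 * ε := by gcongr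
    _ = ε := one_mul _

lemma eq_zero_of_slash {f : ℍ → ℂ} {k : ℤ} (hk : k < 12) (hf : MDiff f)
    (hs : ∀ γ : SL(2, ℤ), f ∣[k] γ = f) (h0 : Tendsto f atImInfty (𝓝 0)) (z : ℍ) : f z = 0 := by
  let g : CuspForm 𝒮ℒ k :=
    { toFun := f
      slash_action_eq' := by
        rintro A ⟨A, rfl⟩
        exact hs A
      holo' := hf
      zero_at_cusps' := by
        intro c hc
        rw [Subgroup.IsArithmetic.isCusp_iff_isCusp_SL2Z] at hc
        rw [OnePoint.isZeroAt_iff_forall_SL2Z hc]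
        intro γ _
        rw [hs]
        exact h0 }
  have hg : g = 0 := rank_zero_iff_forall_zero.mp (CuspForm.rank_eq_zero_of_weight_lt_twelve hk) g
  exact congrArg (fun g : CuspForm 𝒮ℒ k ↦ g z) hg

local notation "DD" => Derivative.normalizedDerivOfComplex
local notation "F2" => EisensteinSeries.E2

lemma F4_slash (γ : SL(2, ℤ)) : (F4 : ℍ → ℂ) ∣[(4 : ℤ)] γ = F4 := F4.slash_action_eq' _ ⟨γ, rfl⟩

lemma F6_slash (γ : SL(2, ℤ)) : (F6 : ℍ → ℂ) ∣[(6 : ℤ)] γ = F6 := F6.slash_action_eq' _ ⟨γ, rfl⟩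

lemma ram4 (z : ℍ) : DD F4 z = (F2 z * F4 z - F6 z) / 3 := by
  have h := eq_zero_of_slash (k := 6)
    (f := Derivative.serreDerivative (4 : ℤ) F4 + (3⁻¹ : ℂ) • (F6 : ℍ → ℂ)) (by norm_num)
    ((Derivative.serreDerivative_mdifferentiable _ F4.holo').add
      ((F6.holo').const_smul (3⁻¹ : ℂ))) (fun γ ↦ by
      rw [SlashAction.add_slash, ModularForm.SL_smul_slash, F6_slash γ]
      exact congrArg (· + _) (Derivative.serreDerivative_slash_invariant (k := 4) F4.holo' (F4_slash γ)))
    (by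
      have := ((tendsto_D F4.holo' tendsto_F4).sub
        (((tendsto_F2.const_mul (4 * 12⁻¹)).mul tendsto_F4))).add (tendsto_F6.const_mul 3⁻¹)
      norm_num at this
      refine this.congr fun z ↦ ?_
      simp
      norm_num) z
  simp at h
  linear_combination h

lemma ram6 (z : ℍ) : DD F6 z = (F2 z * F6 z - F4 z ^ 2) / 2 := by
  have h := eq_zero_of_slash (k := 8)
    (f := Derivative.serreDerivative (6 : ℤ) F6 + (2⁻¹ : ℂ) • ((F4 : ℍ → ℂ) * F4)) (by norm_num)
    ((Derivative.serreDerivative_mdifferentiable _ F6.holo').add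
      ((F4.holo'.mul F4.holo').const_smul (2⁻¹ : ℂ))) (fun γ ↦ by
      rw [SlashAction.add_slash, ModularForm.SL_smul_slash]
      have h1 := ModularForm.mul_slash_SL2 4 4 γ F4 F4
      rw [F4_slash γ] at h1
      norm_num at h1
      rw [h1]
      exact congrArg (· + _) (Derivative.serreDerivative_slash_invariant (k := 6) F6.holo' (F6_slash γ)))
    (by
      have := ((tendsto_D F6.holo' tendsto_F6).sub
        (((tendsto_F2.const_mul (6 * 12⁻¹)).mul tendsto_F6))).add
          ((tendsto_F4.mul tendsto_F4).const_mul 2⁻¹)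
      norm_num at this
      refine this.congr fun z ↦ ?_
      simp
      norm_num) z
  simp at h
  linear_combination h

lemma hasDerivAt_D2 (γ : SL(2, ℤ)) (z : ℍ) :
    HasDerivAt (EisensteinSeries.D2 γ ∘ ofComplex)
      (- (2 * Real.pi * I) * ((γ 1 0 : ℂ) / denom γ z) ^ 2) (z : ℂ) := by
  have h1 := (hasDerivAt_denom_zpow (γ : GL (Fin 2) ℝ) (-1) z).const_mul
    (2 * Real.pi * I * (γ 1 0 : ℂ))
  have h2 := h1.congr_of_eventuallyEq (f₁ := EisensteinSeries.D2 γ ∘ ofComplex) (by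
    filter_upwards [isOpen_upperHalfPlaneSet.mem_nhds z.im_pos] with w hw
    simp [EisensteinSeries.D2, ofComplex_apply_of_im_pos hw, div_eq_mul_inv])
  refine h2.congr_deriv ?_
  have h3 := denom_ne_zero γ z
  rw [show (-1 - 1 : ℤ) = -2 by norm_num, zpow_neg]
  simp
  field_simp

lemma mdiff_D2 (γ : SL(2, ℤ)) : MDiff (EisensteinSeries.D2 γ) := by
  rw [UpperHalfPlane.mdifferentiable_iff]
  intro z hz
  exact (hasDerivAt_D2 γ ⟨z, hz⟩).differentiableAt.differentiableWithinAt

lemma F2_slash (γ : SL(2, ℤ)) (z : ℍ) : (F2 ∣[(2 : ℤ)] γ) z =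
    F2 z - 6 * I / Real.pi * ((γ 1 0 : ℂ) / denom γ z) := by
  have hpi : (Real.pi : ℂ) ≠ 0 := by exact_mod_cast Real.pi_ne_zero
  have h3 := denom_ne_zero γ z
  rw [EisensteinSeries.E2_slash_action]
  simp [EisensteinSeries.D2, riemannZeta_two]
  field_simp

lemma DF2_slash (γ : SL(2, ℤ)) (z : ℍ) : (DD F2 ∣[(4 : ℤ)] γ) z =
    DD F2 z + 2 * (2 * Real.pi * I)⁻¹ * ((γ 1 0 : ℂ) / denom γ z) * F2 z
      - 3 / Real.pi ^ 2 * ((γ 1 0 : ℂ) / denom γ z) ^ 2 := by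
  have hpi : (Real.pi : ℂ) ≠ 0 := by exact_mod_cast Real.pi_ne_zero
  have h := congrFun (Derivative.normalizedDerivOfComplex_SL_slash (k := 2)
    E2_mdifferentiable (γ := γ)) z
  rw [Pi.sub_apply, F2_slash, EisensteinSeries.E2_slash_action,
    Derivative.normalizedDerivOfComplex_sub _ _ E2_mdifferentiable
      ((mdiff_D2 γ).const_smul _), Derivative.normalizedDerivOfComplex_smul _ _ (mdiff_D2 γ)] at h
  have h2 : DD (EisensteinSeries.D2 γ) z = - ((γ 1 0 : ℂ) / denom γ z) ^ 2 := by
    rw [Derivative.normalizedDerivOfComplex, (hasDerivAt_D2 γ z).deriv]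
    have := I_ne_zero
    field_simp
  simp only [Pi.sub_apply, Pi.smul_apply, h2, smul_eq_mul, riemannZeta_two] at h
  norm_num at h
  have hinv : (2 * Real.pi * I : ℂ)⁻¹ = -I * (Real.pi : ℂ)⁻¹ / 2 := by
    rw [mul_inv, Complex.inv_I, mul_inv]
    ring
  rw [hinv]
  linear_combination -h + 6 * ((γ 1 0 : ℂ) / denom γ z) ^ 2 / Real.pi ^ 2 * I_sq

lemma ram2 (z : ℍ) : DD F2 z = (F2 z ^ 2 - F4 z) / 12 := by
  have h := eq_zero_of_slash (k := 4)
    (f := DD F2 - (12⁻¹ : ℂ) • (F2 * F2 - (F4 : ℍ → ℂ))) (by norm_num)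
    ((Derivative.normalizedDerivOfComplex_mdifferentiable E2_mdifferentiable).sub
      (((E2_mdifferentiable.mul E2_mdifferentiable).sub
        F4.holo').const_smul (12⁻¹ : ℂ))) (fun γ ↦ by
      have h1 := ModularForm.mul_slash_SL2 2 2 γ F2 F2
      norm_num at h1
      have hneg : (-(F4 : ℍ → ℂ)) ∣[(4 : ℤ)] γ = -F4 := by
        rw [ModularForm.SL_slash, SlashAction.neg_slash, ← ModularForm.SL_slash, F4_slash γ]
      rw [sub_eq_add_neg, sub_eq_add_neg, SlashAction.add_slash, ModularForm.SL_slash,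
        ModularForm.SL_slash, SlashAction.neg_slash, ← ModularForm.SL_slash,
        ← ModularForm.SL_slash, ModularForm.SL_smul_slash,
        SlashAction.add_slash, h1, hneg]
      ext z
      simp only [Pi.add_apply, Pi.neg_apply, Pi.smul_apply, Pi.mul_apply, DF2_slash, F2_slash,
        smul_eq_mul]
      have hpi : (Real.pi : ℂ) ≠ 0 := by exact_mod_cast Real.pi_ne_zero
      have := I_ne_zero
      have h3 := denom_ne_zero γ z
      field_simp
      ring_nf
      simp [I_sq])
    (by
      have := (tendsto_D E2_mdifferentiable tendsto_F2).sub
        (((tendsto_F2.mul tendsto_F2).sub tendsto_F4).const_mul 12⁻¹)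
      norm_num at this
      refine this.congr fun z ↦ ?_
      simp) z
  simp at h
  linear_combination h

lemma hasDerivAt_of_DD {G : ℍ → ℂ} (hG : MDiff G) {g : ℂ → ℂ} (hg : ∀ z : ℍ, g z = G z) (z : ℍ) :
    HasDerivAt g (2 * Real.pi * I * DD G z) z := by
  rw [UpperHalfPlane.mdifferentiable_iff] at hG
  have h1 := (hG.differentiableAt (isOpen_upperHalfPlaneSet.mem_nhds z.im_pos)).hasDerivAt
  have h2 := h1.congr_of_eventuallyEq (f₁ := g) (by
    filter_upwards [isOpen_upperHalfPlaneSet.mem_nhds z.im_pos] with w hw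
    simp only [Function.comp_apply, ofComplex_apply_of_im_pos hw]
    exact hg ⟨w, hw⟩)
  refine h2.congr_deriv ?_
  rw [Derivative.normalizedDerivOfComplex]
  have hpi : (Real.pi : ℂ) ≠ 0 := by exact_mod_cast Real.pi_ne_zero
  have := I_ne_zero
  field_simp

lemma hasDerivAt_E2 {τ : ℂ} (hτ : 0 < τ.im) :
    HasDerivAt E2 (2 * Real.pi * I * ((E2 τ ^ 2 - E4 τ) / 12)) τ := by
  have := hasDerivAt_of_DD E2_mdifferentiable E2_coe ⟨τ, hτ⟩
  rwa [ram2, ← E2_coe, ← E4_coe] at this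

lemma hasDerivAt_E4 {τ : ℂ} (hτ : 0 < τ.im) :
    HasDerivAt E4 (2 * Real.pi * I * ((E2 τ * E4 τ - E6 τ) / 3)) τ := by
  have := hasDerivAt_of_DD F4.holo' E4_coe ⟨τ, hτ⟩
  erw [ram4] at this
  rwa [← E2_coe, ← E4_coe, ← E6_coe] at this

lemma hasDerivAt_E6 {τ : ℂ} (hτ : 0 < τ.im) :
    HasDerivAt E6 (2 * Real.pi * I * ((E2 τ * E6 τ - E4 τ ^ 2) / 2)) τ := by
  have := hasDerivAt_of_DD F6.holo' E6_coe ⟨τ, hτ⟩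
  erw [ram6] at this
  rwa [← E2_coe, ← E4_coe, ← E6_coe] at this

lemma disc_ne {τ : ℂ} (hτ : 0 < τ.im) : E4 τ ^ 3 - E6 τ ^ 2 ≠ 0 := by
  have h1 := ModularForm.discriminant_eq_E₄_cube_sub_E₆_sq ⟨τ, hτ⟩
  have h2 := ModularForm.discriminant_ne_zero ⟨τ, hτ⟩
  intro h
  apply h2
  rw [h1]
  have e4 := E4_coe ⟨τ, hτ⟩
  have e6 := E6_coe ⟨τ, hτ⟩
  rw [F4] at e4
  rw [F6] at e6
  rw [← e4, ← e6]
  simp [h]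

lemma norm_pow_sub_le {p q : ℂ} {r : ℝ} (hr : 0 ≤ r) (hp : ‖p‖ ≤ r) (hq : ‖q‖ ≤ r) (n : ℕ) :
    ‖p ^ (n + 1) - q ^ (n + 1)‖ ≤ (n + 1) * r ^ n * ‖p - q‖ := by
  induction n with
  | zero => simp
  | succ n ih =>
    have : p ^ (n + 1 + 1) - q ^ (n + 1 + 1) =
        p * (p ^ (n + 1) - q ^ (n + 1)) + q ^ (n + 1) * (p - q) := by ring
    rw [this]
    calc _ ≤ ‖p‖ * ‖p ^ (n + 1) - q ^ (n + 1)‖ + ‖q‖ ^ (n + 1) * ‖p - q‖ := by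
          refine (norm_add_le _ _).trans ?_
          rw [norm_mul, norm_mul, norm_pow]
      _ ≤ r * ((n + 1) * r ^ n * ‖p - q‖) + r ^ (n + 1) * ‖p - q‖ := by gcongr
      _ = _ := by push_cast; ring

lemma norm_sigma_le (n : ℕ) : ‖sigmaC 3 (n + 1)‖ ≤ ((n : ℝ) + 1) ^ 4 := by
  rw [sigmaC_eq, Complex.norm_natCast]
  exact_mod_cast ArithmeticFunction.sigma_le_pow_succ 3 (n + 1)

lemma q_inj {z w : ℍ} (hz : ‖qq z‖ ≤ 1 / 100) (hw : ‖qq w‖ ≤ 1 / 100)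
    (h : E4 z = E4 w) : qq z = qq w := by
  have h1 : ∑' n : ℕ, sigmaC 3 (n + 1) * qq z ^ (n + 1) =
      ∑' n : ℕ, sigmaC 3 (n + 1) * qq w ^ (n + 1) := by
    unfold E4 at h
    linear_combination h / 240
  have hs := (summable_sq 3 z).sub (summable_sq 3 w)
  have h2 : ∑' n : ℕ, (sigmaC 3 (n + 1) * qq z ^ (n + 1) - sigmaC 3 (n + 1) * qq w ^ (n + 1)) = 0 := by
    rw [(summable_sq 3 z).tsum_sub (summable_sq 3 w), h1, sub_self]
  rw [hs.tsum_eq_zero_add] at h2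
  have hg : HasSum (fun n : ℕ ↦ (32 / 100 : ℝ) * (32 / 100) ^ n * ‖qq z - qq w‖)
      ((32 / 100 : ℝ) * (1 - 32 / 100)⁻¹ * ‖qq z - qq w‖) :=
    ((hasSum_geometric_of_lt_one (by norm_num) (by norm_num)).mul_left _).mul_right _
  have h3 : ‖∑' n : ℕ, (sigmaC 3 (n + 1 + 1) * qq z ^ (n + 1 + 1)
      - sigmaC 3 (n + 1 + 1) * qq w ^ (n + 1 + 1))‖ ≤
      (32 / 100 : ℝ) * (1 - 32 / 100)⁻¹ * ‖qq z - qq w‖ := by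
    refine tsum_of_norm_bounded hg fun n ↦ ?_
    rw [← mul_sub, norm_mul]
    have hb : ((n + 1 : ℕ) : ℝ) + 1 ≤ 2 ^ (n + 1) := by
      exact_mod_cast Nat.lt_two_pow_self (n := n + 1)
    calc _ ≤ (((n + 1 : ℕ) : ℝ) + 1) ^ 4 *
          ((((n + 1 : ℕ) : ℝ) + 1) * (1 / 100) ^ (n + 1) * ‖qq z - qq w‖) := by
            gcongr
            · exact norm_sigma_le _
            · exact norm_pow_sub_le (by norm_num) hz hw _
      _ = (((n + 1 : ℕ) : ℝ) + 1) ^ 5 * (1 / 100) ^ (n + 1) * ‖qq z - qq w‖ := by ring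
      _ ≤ (2 ^ (n + 1)) ^ 5 * (1 / 100) ^ (n + 1) * ‖qq z - qq w‖ := by gcongr
      _ = (32 / 100 : ℝ) ^ (n + 1) * ‖qq z - qq w‖ := by
            rw [← pow_mul, mul_comm (n + 1) 5, pow_mul, ← mul_pow]; norm_num
      _ = _ := by rw [pow_succ']
  have h4 : sigmaC 3 (0 + 1) = 1 := by simp [sigmaC]
  rw [h4, add_eq_zero_iff_eq_neg] at h2
  have h5 : ‖qq z - qq w‖ ≤ (32 / 100 : ℝ) * (1 - 32 / 100)⁻¹ * ‖qq z - qq w‖ := by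
    refine le_trans (le_of_eq ?_) h3
    rw [← norm_neg (∑' n : ℕ, _), ← h2]
    simp
  norm_num at h5
  have h6 : ‖qq z - qq w‖ = 0 := by linarith [norm_nonneg (qq z - qq w)]
  exact sub_eq_zero.mp (norm_eq_zero.mp h6)

def rho : ℍ := ⟨⟨-1 / 2, Real.sqrt 3 / 2⟩, by positivity⟩

lemma qq_small {z : ℍ} (hz : 3 ≤ 4 * z.im ^ 2) : ‖qq z‖ ≤ 1 / 100 := by
  rw [norm_qq]
  have h0 : (z : ℂ).im = z.im := rfl
  rw [h0]
  have h1 : 0.85 ≤ z.im := by nlinarith [z.im_pos]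
  have h2 : -2 * Real.pi * z.im ≤ -5 := by nlinarith [Real.pi_gt_three]
  calc Real.exp (-2 * Real.pi * z.im) ≤ Real.exp (-5) := Real.exp_le_exp.mpr h2
    _ ≤ 1 / 100 := by
      rw [Real.exp_neg, one_div]
      apply inv_anti₀ (by norm_num)
      have h3 : Real.exp 5 = Real.exp 1 ^ 5 := by rw [← Real.exp_nat_mul]; norm_num
      rw [h3]
      calc (100 : ℝ) ≤ 2.7 ^ 5 := by norm_num
        _ ≤ _ := by gcongr; linarith [Real.exp_one_gt_d9]

lemma E4_smul (γ : SL(2, ℤ)) (z : ℍ) :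
    E4 ((γ • z : ℍ) : ℂ) = denom γ z ^ 4 * E4 z := by
  have h := congrFun (F4_slash γ) z
  rw [ModularForm.SL_slash_apply, zpow_neg, ← E4_coe, ← E4_coe] at h
  have h3 := denom_ne_zero γ z
  rw [← h]
  norm_cast
  field_simp

lemma E2_smul (γ : SL(2, ℤ)) (z : ℍ) :
    E2 ((γ • z : ℍ) : ℂ) = denom γ z ^ 2 * E2 z - 6 * I / Real.pi * (γ 1 0 : ℂ) * denom γ z := by
  have h := F2_slash γ z
  rw [ModularForm.SL_slash_apply, zpow_neg, ← E2_coe, ← E2_coe] at h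
  have h3 := denom_ne_zero γ z
  have hpi : (Real.pi : ℂ) ≠ 0 := by exact_mod_cast Real.pi_ne_zero
  norm_cast at h
  rw [← div_eq_mul_inv, div_eq_iff (by positivity)] at h
  rw [h]
  field_simp

lemma qq_S_rho : qq ((S • rho : ℍ) : ℂ) = qq rho := by
  have h : ((S • rho : ℍ) : ℂ) = rho + 1 := by
    rw [modular_S_smul]
    have h3 : ((Real.sqrt 3 : ℝ) : ℂ) ^ 2 = 3 := by
      norm_cast
      exact Real.sq_sqrt (by norm_num)
    have h0 := rho.ne_zero
    change (-(rho : ℂ))⁻¹ = rho + 1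
    symm
    apply eq_inv_of_mul_eq_one_left
    have : (rho : ℂ) = -1 / 2 + Real.sqrt 3 / 2 * I := by
      apply Complex.ext <;> simp [rho]
    rw [this]
    linear_combination (-I ^ 2 / 4) * h3 - 3 / 4 * I_sq
  rw [h, qq, qq, mul_add, Complex.exp_add, mul_one, Complex.exp_two_pi_mul_I, mul_one]

lemma denom_S_rho : denom S rho = -1 / 2 + Real.sqrt 3 / 2 * I := by
  rw [ModularGroup.denom_S]
  apply Complex.ext <;> simp [rho]

lemma sqrt3_sq : ((Real.sqrt 3 : ℝ) : ℂ) ^ 2 = 3 := by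
  norm_cast
  exact Real.sq_sqrt (by norm_num)

lemma E4_rho : E4 rho = 0 := by
  have h := E4_smul S rho
  have h1 : E4 ((S • rho : ℍ) : ℂ) = E4 rho := by rw [E4, qq_S_rho, E4]
  have h3 := sqrt3_sq
  rw [h1, denom_S_rho] at h
  have h4 : (-1 / 2 + Real.sqrt 3 / 2 * I : ℂ) ^ 4 = -1 / 2 + Real.sqrt 3 / 2 * I := by
    have : (-1 / 2 + Real.sqrt 3 / 2 * I : ℂ) ^ 2 = -1 / 2 - Real.sqrt 3 / 2 * I := by
      linear_combination (I ^ 2 / 4) * h3 + 3 / 4 * I_sq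
    rw [show (-1 / 2 + Real.sqrt 3 / 2 * I : ℂ) ^ 4 = ((-1 / 2 + Real.sqrt 3 / 2 * I : ℂ) ^ 2) ^ 2 by ring,
      this]
    linear_combination (I ^ 2 / 4) * h3 + 3 / 4 * I_sq
  rw [h4] at h
  have h5 : (3 / 2 - Real.sqrt 3 / 2 * I : ℂ) * E4 rho = 0 := by linear_combination h
  rcases mul_eq_zero.mp h5 with h6 | h6
  · have := congrArg Complex.re h6
    norm_num at this
  · exact h6

lemma E2_rho : E2 rho = 2 * Real.sqrt 3 / Real.pi := by
  have h := E2_smul S rho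
  have h1 : E2 ((S • rho : ℍ) : ℂ) = E2 rho := by rw [E2, qq_S_rho, E2]
  have h3 := sqrt3_sq
  have hS : ((S : SL(2, ℤ)) 1 0 : ℂ) = 1 := by simp [S]
  rw [h1, denom_S_rho, hS] at h
  have hpi : (Real.pi : ℂ) ≠ 0 := by exact_mod_cast Real.pi_ne_zero
  have h4 : (3 / 2 + Real.sqrt 3 / 2 * I : ℂ) ≠ 0 := by
    intro h6
    have := congrArg Complex.re h6
    norm_num at this
  apply mul_left_cancel₀ h4
  linear_combination h + (I ^ 2 / 4 * E2 rho - I / Real.pi) * h3 +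
    (3 / 4 * E2 rho - 3 * Real.sqrt 3 / Real.pi) * I_sq

lemma E2_ne_of_E4 (z : ℍ) (h4 : E4 z = 0) : E2 z ≠ 0 := by
  intro h2
  obtain ⟨γ, hγ⟩ := exists_smul_mem_fd z
  have him := three_le_four_mul_im_sq_of_mem_fd hγ
  have h3 := Real.sq_sqrt (show (0 : ℝ) ≤ 3 by norm_num)
  have hrim : rho.im = Real.sqrt 3 / 2 := rfl
  have hw4 : E4 ((γ • z : ℍ) : ℂ) = 0 := by rw [E4_smul, h4, mul_zero]
  have hq : qq ((γ • z : ℍ) : ℂ) = qq rho := by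
    apply q_inj (qq_small him) (qq_small _) (by rw [hw4, E4_rho])
    rw [hrim]
    nlinarith
  have hw2 : E2 ((γ • z : ℍ) : ℂ) = 2 * Real.sqrt 3 / Real.pi := by
    rw [← E2_rho, E2, hq, E2]
  have hwim : (γ • z).im = Real.sqrt 3 / 2 := by
    have := congrArg norm hq
    rw [norm_qq, norm_qq, Real.exp_eq_exp] at this
    rw [← hrim]
    exact mul_left_cancel₀ (by simp [Real.pi_ne_zero]) this
  rw [E2_smul, h2] at hw2
  have hpi : (Real.pi : ℂ) ≠ 0 := by exact_mod_cast Real.pi_ne_zero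
  have hd : -3 * I * (γ 1 0 : ℂ) * denom γ z = Real.sqrt 3 := by
    field_simp at hw2
    linear_combination hw2 / 2
  rw [ModularGroup.im_smul_eq_div_normSq, ModularGroup.denom_apply] at hwim
  rw [ModularGroup.denom_apply] at hd
  have hre := congrArg Complex.re hd
  have hi := congrArg Complex.im hd
  simp [Complex.normSq_apply] at hre hi hwim
  have hy := z.im_pos
  set c : ℝ := ((γ 1 0 : ℤ) : ℝ)
  have hs : 0 < Real.sqrt 3 := by positivity
  have hc : c ≠ 0 := by
    intro hc
    rw [hc] at hre
    simp at hre
    linarith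
  have hr : c * z.re + ((γ 1 1 : ℤ) : ℝ) = 0 := by
    refine hi.resolve_left fun h0 ↦ hc ?_
    simp [c, h0]
  rw [hr] at hwim
  have hcy : c * z.im ≠ 0 := mul_ne_zero hc hy.ne'
  rw [div_eq_iff (by simpa using ⟨hc, z.im_ne_zero⟩)] at hwim
  have h6 : z.im = z.im * (1 / 2) := by
    linear_combination hwim + (Real.sqrt 3 * z.im / 6) * hre + (z.im / 6) * h3
  linarith

lemma core {τ : ℂ} (hτ : 0 < τ.im) (h : E4 τ ^ 2 - E2 τ * E6 τ = 0) :
    2 * E4 τ * ((E2 τ * E4 τ - E6 τ) / 3) - ((E2 τ ^ 2 - E4 τ) / 12) * E6 τ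
      - E2 τ * ((E2 τ * E6 τ - E4 τ ^ 2) / 2) ≠ 0 := by
  intro hb
  have hd := disc_ne hτ
  have h6 : E6 τ ≠ 0 := by
    intro h6
    rw [h6, mul_zero, sub_zero] at h
    apply hd
    rw [h6, pow_eq_zero_iff (two_ne_zero) |>.mp h]
    ring
  have h7 : E4 τ * (E4 τ ^ 3 - E6 τ ^ 2) = 0 := by
    linear_combination (12 * E6 τ / 7) * hb + (8 / 7 * E4 τ ^ 2 - E4 τ ^ 2 / 7 - E2 τ * E6 τ / 7 - 6 / 7 * E2 τ * E6 τ) * h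
  have h8 : E4 τ = 0 := (mul_eq_zero.mp h7).resolve_right hd
  have h9 : E2 τ = 0 := by
    rw [h8] at h
    have : E2 τ * E6 τ = 0 := by linear_combination -h
    exact (mul_eq_zero.mp this).resolve_right h6
  exact E2_ne_of_E4 ⟨τ, hτ⟩ h8 h9

lemma hasDerivAt_K {τ : ℂ} (hτ : 0 < τ.im) :
    HasDerivAt (fun τ ↦ E4 τ ^ 2 - E2 τ * E6 τ) (2 * Real.pi * I *
      (2 * E4 τ * ((E2 τ * E4 τ - E6 τ) / 3) - ((E2 τ ^ 2 - E4 τ) / 12) * E6 τ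
      - E2 τ * ((E2 τ * E6 τ - E4 τ ^ 2) / 2))) τ := by
  refine (((hasDerivAt_E4 hτ).pow 2).sub
    ((hasDerivAt_E2 hτ).mul (hasDerivAt_E6 hτ))).congr_deriv ?_
  push_cast
  ring

lemma hh_eq (τ : ℂ) : hh τ = (16 * (Real.pi : ℂ) ^ 8 / 9) * (E4 τ ^ 2 - E2 τ * E6 τ) := by
  rw [hh, g2, g3, eta1]
  ring

lemma hasDerivAt_g3 {τ : ℂ} (hτ : 0 < τ.im) :
    HasDerivAt g3 (-(8 * (Real.pi : ℂ) ^ 7 * I / 27) * (E4 τ ^ 2 - E2 τ * E6 τ)) τ := by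
  refine ((hasDerivAt_E6 hτ).const_mul (8 * (Real.pi : ℂ) ^ 6 / 27)).congr_deriv ?_
  ring

end

theorem zeros_simple (τ : ℂ) (hτ : 0 < τ.im) :
    (hh τ = 0 → deriv hh τ ≠ 0) ∧ (deriv g3 τ = 0 → deriv (deriv g3) τ ≠ 0) := by
  have hpi : (Real.pi : ℂ) ≠ 0 := by exact_mod_cast Real.pi_ne_zero
  have hI := Complex.I_ne_zero
  constructor
  · intro h
    rw [hh_eq] at h
    have hK := (mul_eq_zero.mp h).resolve_left (by simp [hpi])
    rw [show hh = fun τ ↦ (16 * (Real.pi : ℂ) ^ 8 / 9) * (E4 τ ^ 2 - E2 τ * E6 τ) from funext hh_eq,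
      ((hasDerivAt_K hτ).const_mul _).deriv]
    exact mul_ne_zero (by simp [hpi]) (mul_ne_zero (by simp [hpi]) (core hτ hK))
  · intro h
    rw [(hasDerivAt_g3 hτ).deriv] at h
    have hK := (mul_eq_zero.mp h).resolve_left (by simp [hpi])
    have he : deriv g3 =ᶠ[nhds τ]
        fun τ ↦ -(8 * (Real.pi : ℂ) ^ 7 * I / 27) * (E4 τ ^ 2 - E2 τ * E6 τ) := by
      filter_upwards [(isOpen_lt continuous_const Complex.continuous_im).mem_nhds hτ] with z hz
      exact (hasDerivAt_g3 hz).deriv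
    rw [he.deriv_eq, ((hasDerivAt_K hτ).const_mul _).deriv]
    exact mul_ne_zero (by simp [hpi]) (mul_ne_zero (by simp [hpi]) (core hτ hK))
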